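/- Let α = β > 0, μ > 0, and set μ_N = μ/N². For every Schwartz function f ∈ S(ℝ) there exists a constant C = C(f, α, β, μ) > 0 such that for every integer N ≥ 2 and every z ∈ H_N one has |L_N R_f(z)| ≤ C/N². -/

import Mathlib

open scoped BigOperators
open Filter

/-- Indicator sequence of `{j}` in `ℤ → ℝ`. -/
noncomputable def eZ (j : ℤ) : ℤ → ℝ := fun k => if k = j then 1 else 0

/-- The sequence `e_{l+1} + ⋯ + e_k` (indicator of `(l, k]`). -/
noncomputable def eBlock (l k : ℤ) : ℤ → ℝ := fun m => if l < m ∧ m ≤ k then 1 else 0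

/-- The state space `H_N`: nonincreasing `z : ℤ → ℝ` with values in `{l/N : 0 ≤ l ≤ N}`,
tending to `1` at `-∞` and to `0` at `+∞`. -/
def HN (N : ℕ) : Set (ℤ → ℝ) :=
  {z | Antitone z ∧
       (∀ k : ℤ, ∃ l : ℕ, l ≤ N ∧ z k = (l : ℝ) / N) ∧
       Tendsto z atBot (nhds 1) ∧
       Tendsto z atTop (nhds 0)}

/-- `R_f(z) = (1/N) ∑_{k ∈ ℤ} f(k/N) z_k`. -/
noncomputable def Rf (N : ℕ) (f : SchwartzMap ℝ ℝ) (z : ℤ → ℝ) : ℝ :=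
  (1 / (N : ℝ)) * ∑' k : ℤ, f ((k : ℝ) / N) * z k

/-- The generator `L_N` with jump rates `α` (right), `β` (left) and interaction rate `μN`,
applied to a function `F` of the configuration `z`. -/
noncomputable def LN (N : ℕ) (α β μN : ℝ) (F : (ℤ → ℝ) → ℝ) (z : ℤ → ℝ) : ℝ :=
  (N : ℝ) * ∑' k : ℤ,
      ((F (z + ((N : ℝ))⁻¹ • eZ k) - F z) * α * (z (k - 1) - z k) +
       (F (z - ((N : ℝ))⁻¹ • eZ k) - F z) * β * (z k - z (k + 1))) +
  (N : ℝ) * μN * ∑' l : ℤ, ∑' k : ℤ,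
      if l < k then
        (F (z - ((N : ℝ))⁻¹ • eBlock l k) - F z) * (z k - z (k + 1)) * (z l - z (l + 1))
      else 0

/-- Riemann sums of `x ↦ (1 + x ^ 2)⁻¹` with mesh `1 / N` are bounded uniformly in `N`. -/
theorem exists_hasSum_inv_one_add_sq_le :
    ∃ S : ℝ, 0 < S ∧ ∀ N : ℕ, 0 < N →
      ∃ T : ℝ, T ≤ N * S ∧ HasSum (fun k : ℤ => (1 + ((k : ℝ) / N) ^ 2)⁻¹) T := by
  have hs : Summable (fun q : ℤ => 3 * (1 + (q : ℝ) ^ 2)⁻¹) := by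
    refine Summable.mul_left 3 ?_
    have h2 : Summable (fun q : ℤ => 1 / (q : ℝ) ^ 2) :=
      Real.summable_one_div_int_pow.2 (by norm_num)
    refine Summable.of_norm_bounded_eventually h2 ?_
    filter_upwards [(Set.finite_singleton (0 : ℤ)).compl_mem_cofinite] with q hq
    have hq : (q : ℝ) ≠ 0 := by exact_mod_cast hq
    rw [Real.norm_of_nonneg (by positivity), ← one_div]
    have : 0 < (q : ℝ) ^ 2 := by positivity
    exact one_div_le_one_div_of_le this (by linarith)
  have hpos : ∀ q : ℤ, 0 ≤ 3 * (1 + (q : ℝ) ^ 2)⁻¹ := fun q => by positivity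
  refine ⟨∑' q : ℤ, 3 * (1 + (q : ℝ) ^ 2)⁻¹, hs.tsum_pos hpos 0 (by norm_num), ?_⟩
  intro N hN
  have : NeZero N := ⟨hN.ne'⟩
  have hN' : (0 : ℝ) < N := by exact_mod_cast hN
  have h1 : HasSum (fun _ : Fin N => (1 : ℝ)) N := by
    simpa using hasSum_fintype (fun _ : Fin N => (1 : ℝ))
  have hprod : HasSum (fun x : ℤ × Fin N => 3 * (1 + (x.1 : ℝ) ^ 2)⁻¹ * (1 : ℝ))
      ((∑' q : ℤ, 3 * (1 + (q : ℝ) ^ 2)⁻¹) * (N : ℝ)) :=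
    hs.hasSum.mul h1 (hs.mul_of_nonneg h1.summable hpos (fun _ => zero_le_one))
  have hcomp := (Int.divModEquiv N).hasSum_iff.2 hprod
  have hle : ∀ k : ℤ, (1 + ((k : ℝ) / N) ^ 2)⁻¹ ≤
      ((fun x : ℤ × Fin N => 3 * (1 + (x.1 : ℝ) ^ 2)⁻¹ * (1 : ℝ)) ∘ Int.divModEquiv N) k := by
    intro k
    have hq : ((Int.divModEquiv N) k).1 = k / N := rfl
    simp only [Function.comp, hq, mul_one]
    have hN0 : (0 : ℤ) < N := by exact_mod_cast hN
    have e1 : ((k / (N : ℤ) : ℤ) : ℝ) ≤ (k : ℝ) / N := by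
      rw [le_div_iff₀ hN']
      exact_mod_cast Int.ediv_mul_le k hN0.ne'
    have e2 : (k : ℝ) / N ≤ ((k / (N : ℤ) : ℤ) : ℝ) + 1 := by
      rw [div_le_iff₀ hN']
      exact_mod_cast (Int.lt_ediv_add_one_mul_self k hN0).le
    rw [← div_eq_mul_inv, inv_eq_one_div, div_le_div_iff₀ (by positivity) (by positivity)]
    nlinarith [sq_nonneg ((k : ℝ) / N + ((k : ℝ) / N - ((k / (N : ℤ) : ℤ) : ℝ)))]
  have hsum : Summable (fun k : ℤ => (1 + ((k : ℝ) / N) ^ 2)⁻¹) :=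
    Summable.of_nonneg_of_le (fun k => by positivity) hle hcomp.summable
  exact ⟨_, (hasSum_le hle hsum.hasSum hcomp).trans (mul_comm _ _).le, hsum.hasSum⟩

theorem SchwartzMap.exists_abs_le_inv_one_add_sq (f : SchwartzMap ℝ ℝ) :
    ∃ D : ℝ, 0 < D ∧ ∀ x, |f x| ≤ D * (1 + x ^ 2)⁻¹ := by
  obtain ⟨A, hA, hA'⟩ := f.decay 0 0
  obtain ⟨B, hB, hB'⟩ := f.decay 2 0
  refine ⟨A + B, by positivity, fun x => ?_⟩
  have h0 := hA' x
  have h2 := hB' x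
  simp only [norm_iteratedFDeriv_zero, Real.norm_eq_abs, sq_abs, pow_zero, one_mul] at h0 h2
  rw [← div_eq_mul_inv, le_div_iff₀ (by positivity)]
  linarith

/-- Second differences of a `C²` function are controlled by its second derivative. -/
theorem abs_second_difference_le {f f' f'' : ℝ → ℝ} (hf : ∀ x, HasDerivAt f (f' x) x)
    (hf' : ∀ x, HasDerivAt f' (f'' x) x) {x h M : ℝ} (hh : 0 ≤ h)
    (hM : ∀ y ∈ Set.Icc (x - h) (x + h), |f'' y| ≤ M) :
    |f (x + h) - 2 * f x + f (x - h)| ≤ 2 * M * h ^ 2 := by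
  have hM0 : 0 ≤ M := (abs_nonneg _).trans (hM x ⟨by linarith, by linarith⟩)
  have hd : ∀ t ∈ Set.Icc 0 h, |f' (x + t) - f' (x - t)| ≤ 2 * M * h := by
    intro t ht
    have := (convex_Icc (x - h) (x + h)).norm_image_sub_le_of_norm_hasDerivWithin_le
      (fun y _ => (hf' y).hasDerivWithinAt) hM
      (x := x - t) (y := x + t) ⟨by linarith [ht.2], by linarith [ht.1]⟩
      ⟨by linarith [ht.1], by linarith [ht.2]⟩
    rw [Real.norm_eq_abs, Real.norm_eq_abs] at this
    refine this.trans ?_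
    rw [abs_of_nonneg (by linarith [ht.1])]
    nlinarith [ht.2]
  have hφ : ∀ t, HasDerivAt (fun t => f (x + t) + f (x - t)) (f' (x + t) - f' (x - t)) t := by
    intro t
    have h1 := (hf (x + t)).comp_const_add x t
    have h2 := (hf (x - t)).comp_const_sub x t
    rw [sub_eq_add_neg]
    exact h1.add h2
  have := (convex_Icc 0 h).norm_image_sub_le_of_norm_hasDerivWithin_le
    (fun t _ => (hφ t).hasDerivWithinAt) hd (x := 0) (y := h) ⟨le_rfl, hh⟩ ⟨hh, le_rfl⟩
  rw [Real.norm_eq_abs, Real.norm_eq_abs] at this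
  simp only [add_zero, sub_zero, abs_of_nonneg hh] at this
  calc |f (x + h) - 2 * f x + f (x - h)| = |f (x + h) + f (x - h) - (f x + f x)| := by
        congr 1; ring
    _ ≤ 2 * M * h * h := this
    _ = 2 * M * h ^ 2 := by ring

theorem SchwartzMap.exists_abs_second_difference_le (f : SchwartzMap ℝ ℝ) :
    ∃ D : ℝ, 0 < D ∧ ∀ x h, 0 ≤ h → h ≤ 1 →
      |f (x + h) - 2 * f x + f (x - h)| ≤ D * h ^ 2 * (1 + x ^ 2)⁻¹ := by
  have hder : ∀ (g : SchwartzMap ℝ ℝ) (x : ℝ),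
      HasDerivAt g (SchwartzMap.derivCLM ℝ ℝ g x) x := fun g x => by
    rw [SchwartzMap.derivCLM_apply]
    exact g.differentiableAt.hasDerivAt
  obtain ⟨D, hD, hD'⟩ := (SchwartzMap.derivCLM ℝ ℝ
    (SchwartzMap.derivCLM ℝ ℝ f)).exists_abs_le_inv_one_add_sq
  refine ⟨6 * D, by positivity, fun x h hh h1 => ?_⟩
  refine (abs_second_difference_le (M := D * (3 * (1 + x ^ 2)⁻¹)) (hder f)
    (hder _) hh ?_).trans (le_of_eq (by ring))
  intro y hy
  refine (hD' y).trans (mul_le_mul_of_nonneg_left ?_ hD.le)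
  rw [← div_eq_mul_inv, inv_eq_one_div, div_le_div_iff₀ (by positivity) (by positivity)]
  have hxy : (x - y) ^ 2 ≤ 1 := by
    rw [sq_le_one_iff_abs_le_one, abs_le]
    exact ⟨by linarith [hy.2], by linarith [hy.1]⟩
  nlinarith [sq_nonneg (y + (y - x))]

theorem HN.mem_Icc {N : ℕ} (hN : 0 < N) {z : ℤ → ℝ} (hz : z ∈ HN N) (k : ℤ) :
    0 ≤ z k ∧ z k ≤ 1 := by
  obtain ⟨l, hl, h⟩ := hz.2.1 k
  have hN' : (0 : ℝ) < N := by exact_mod_cast hN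
  rw [h, div_le_one hN']
  exact ⟨by positivity, by exact_mod_cast hl⟩

theorem HN.nonneg_sub {N : ℕ} {z : ℤ → ℝ} (hz : z ∈ HN N) (k : ℤ) : 0 ≤ z k - z (k + 1) :=
  sub_nonneg.2 (hz.1 (by linarith))

theorem sum_Ico_int_sub (z : ℤ → ℝ) {a b : ℤ} (hab : a ≤ b) :
    ∑ k ∈ Finset.Ico a b, (z k - z (k + 1)) = z a - z b := by
  induction b, hab using Int.leInduction with
  | base => simp
  | succ b hb ih =>
    rw [← Finset.insert_Ico_right_eq_Ico_add_one hb, Finset.sum_insert (by simp), ih]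
    ring

theorem HN.sum_sub_le_one {N : ℕ} (hN : 0 < N) {z : ℤ → ℝ} (hz : z ∈ HN N) (s : Finset ℤ) :
    ∑ k ∈ s, (z k - z (k + 1)) ≤ 1 := by
  obtain ⟨a, ha⟩ := s.bddBelow
  obtain ⟨b, hb⟩ := s.bddAbove
  rcases s.eq_empty_or_nonempty with rfl | ⟨c, hc⟩
  · simp
  have hab : a ≤ b + 1 := by
    have h1 : a ≤ c := ha hc
    have h2 : c ≤ b := hb hc
    omega
  calc ∑ k ∈ s, (z k - z (k + 1)) ≤ ∑ k ∈ Finset.Ico a (b + 1), (z k - z (k + 1)) := by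
        refine Finset.sum_le_sum_of_subset_of_nonneg (fun k hk => ?_)
          (fun k _ _ => HN.nonneg_sub hz k)
        have h1 : a ≤ k := ha hk
        have h2 : k ≤ b := hb hk
        exact Finset.mem_Ico.2 ⟨h1, by omega⟩
    _ = z a - z (b + 1) := sum_Ico_int_sub z hab
    _ ≤ 1 := by linarith [(HN.mem_Icc hN hz a).2, (HN.mem_Icc hN hz (b + 1)).1]

theorem HN.exists_hasSum_sub {N : ℕ} (hN : 0 < N) {z : ℤ → ℝ} (hz : z ∈ HN N) :
    ∃ P : ℝ, 0 ≤ P ∧ P ≤ 1 ∧ HasSum (fun k : ℤ => z k - z (k + 1)) P :=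
  ⟨_, tsum_nonneg (HN.nonneg_sub hz),
    Real.tsum_le_of_sum_le (HN.nonneg_sub hz) (HN.sum_sub_le_one hN hz),
    (summable_of_sum_le (HN.nonneg_sub hz) (HN.sum_sub_le_one hN hz)).hasSum⟩

theorem Summable.mul_of_abs_le_one {ι : Type*} {a b : ι → ℝ} (ha : Summable a)
    (hb : ∀ i, |b i| ≤ 1) : Summable (fun i => a i * b i) := by
  refine Summable.of_norm_bounded ha.abs fun i => ?_
  rw [Real.norm_eq_abs, abs_mul]
  exact mul_le_of_le_one_right (abs_nonneg _) (hb i)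

theorem abs_tsum_le_of_hasSum {ι : Type*} {a b : ι → ℝ} {B : ℝ} (hb : HasSum b B)
    (h : ∀ i, |a i| ≤ b i) : |∑' i, a i| ≤ B := by
  rw [← Real.norm_eq_abs]
  exact tsum_of_norm_bounded hb h

theorem Rf_add_smul {N : ℕ} {f : SchwartzMap ℝ ℝ}
    (hf : Summable fun k : ℤ => f ((k : ℝ) / N)) {z w : ℤ → ℝ}
    (hz : ∀ k, |z k| ≤ 1) (hw : ∀ k, |w k| ≤ 1) (c : ℝ) :
    Rf N f (z + c • w) - Rf N f z = c * Rf N f w := by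
  have h1 := (hf.mul_of_abs_le_one hz).hasSum
  have h2 := (hf.mul_of_abs_le_one hw).hasSum
  have h3 : HasSum (fun k : ℤ => f ((k : ℝ) / N) * (z + c • w) k)
      (∑' k : ℤ, f ((k : ℝ) / N) * z k + c * ∑' k : ℤ, f ((k : ℝ) / N) * w k) := by
    convert h1.add (h2.mul_left c) using 2
    simp only [Pi.add_apply, Pi.smul_apply, smul_eq_mul]
    ring
  unfold Rf
  rw [h3.tsum_eq]
  ring

theorem Rf_eZ (N : ℕ) (f : SchwartzMap ℝ ℝ) (j : ℤ) :
    Rf N f (eZ j) = 1 / (N : ℝ) * f ((j : ℝ) / N) := by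
  unfold Rf eZ
  rw [tsum_eq_single j (fun k hk => by simp [hk])]
  simp

theorem abs_eZ_le_one (j k : ℤ) : |eZ j k| ≤ 1 := by
  unfold eZ
  split_ifs <;> simp

theorem abs_eBlock_le_one (l j k : ℤ) : |eBlock l j k| ≤ 1 := by
  unfold eBlock
  split_ifs <;> simp

theorem tsum_mul_second_difference {a z : ℤ → ℝ} (ha : Summable a) (hz : ∀ k, |z k| ≤ 1) :
    ∑' k, a k * (z (k - 1) - 2 * z k + z (k + 1)) =
      ∑' k, (a (k + 1) - 2 * a k + a (k - 1)) * z k := by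
  have hp : Summable fun k => a (k + 1) := (Equiv.addRight (1 : ℤ)).summable_iff.2 ha
  have hm : Summable fun k => a (k - 1) := (Equiv.subRight (1 : ℤ)).summable_iff.2 ha
  have h0 := (ha.mul_of_abs_le_one hz).hasSum
  have h1 := (hp.mul_of_abs_le_one hz).hasSum
  have h2 := (hm.mul_of_abs_le_one hz).hasSum
  have h1' := (Equiv.subRight (1 : ℤ)).hasSum_iff.2 h1
  have h2' := (Equiv.addRight (1 : ℤ)).hasSum_iff.2 h2
  have hL : HasSum (fun k => a k * (z (k - 1) - 2 * z k + z (k + 1)))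
      (∑' k, a (k + 1) * z k - 2 * ∑' k, a k * z k +
      ∑' k, a (k - 1) * z k) := by
    refine ((h1'.sub (h0.mul_left 2)).add h2').congr_fun fun k => ?_
    simp only [Function.comp, Equiv.subRight_apply, Equiv.coe_addRight, sub_add_cancel,
      add_sub_cancel_right]
    ring
  have hR : HasSum (fun k => (a (k + 1) - 2 * a k + a (k - 1)) * z k)
      (∑' k, a (k + 1) * z k - 2 * ∑' k, a k * z k +
      ∑' k, a (k - 1) * z k) := by
    refine ((h1.sub (h0.mul_left 2)).add h2).congr_fun fun k => ?_
    ring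
  exact hL.tsum_eq.trans hR.tsum_eq.symm

/-- for `α = β > 0`, `μ_N = μ/N²`, the bound `|L_N R_f(z)| ≤ C/N²` holds
uniformly in `N ≥ 2` and `z ∈ H_N`. -/
theorem statement2 (α β μ : ℝ) (hα : 0 < α) (hαβ : α = β) (hμ : 0 < μ)
    (f : SchwartzMap ℝ ℝ) :
    ∃ C : ℝ, 0 < C ∧ ∀ N : ℕ, 2 ≤ N → ∀ z ∈ HN N,
      |LN N α β (μ / (N : ℝ) ^ 2) (Rf N f) z| ≤ C / (N : ℝ) ^ 2 := by
  subst hαβ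
  obtain ⟨S, hS, hS'⟩ := exists_hasSum_inv_one_add_sq_le
  obtain ⟨D, hD, hD'⟩ := f.exists_abs_le_inv_one_add_sq
  obtain ⟨E, hE, hE'⟩ := f.exists_abs_second_difference_le
  refine ⟨α * E * S + μ * D * S, by positivity, fun N hN z hz => ?_⟩
  have hN0 : 0 < N := by omega
  have hNpos : (0 : ℝ) < N := by exact_mod_cast hN0
  have hN1 : (1 : ℝ) ≤ N := by exact_mod_cast hN0
  obtain ⟨T, hT, hT'⟩ := hS' N hN0
  obtain ⟨P, hP0, hP1, hP⟩ := HN.exists_hasSum_sub hN0 hz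
  have hz1 : ∀ k, |z k| ≤ 1 := fun k =>
    abs_le.2 ⟨by linarith [(HN.mem_Icc hN0 hz k).1], (HN.mem_Icc hN0 hz k).2⟩
  have hf : Summable fun k : ℤ => f ((k : ℝ) / N) :=
    Summable.of_norm_bounded (hT'.mul_left D).summable fun k => hD' _
  have hRf : ∀ w : ℤ → ℝ, (∀ k, |w k| ≤ 1) → |Rf N f w| ≤ D * S := by
    intro w hw
    have : |∑' k : ℤ, f ((k : ℝ) / N) * w k| ≤ D * T := by
      refine abs_tsum_le_of_hasSum (hT'.mul_left D) fun k => ?_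
      rw [abs_mul]
      exact (mul_le_of_le_one_right (abs_nonneg _) (hw k)).trans (hD' _)
    unfold Rf
    rw [abs_mul, abs_of_nonneg (by positivity), one_div, inv_mul_le_iff₀ hNpos]
    nlinarith
  have hsub : ∀ w : ℤ → ℝ, (∀ k, |w k| ≤ 1) →
      Rf N f (z - ((N : ℝ))⁻¹ • w) - Rf N f z = -((N : ℝ))⁻¹ * Rf N f w := by
    intro w hw
    rw [← Rf_add_smul hf hz1 hw, neg_smul, sub_eq_add_neg z]
  have hdiff : |(N : ℝ) * ∑' k : ℤ,
      ((Rf N f (z + ((N : ℝ))⁻¹ • eZ k) - Rf N f z) * α * (z (k - 1) - z k) +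
       (Rf N f (z - ((N : ℝ))⁻¹ • eZ k) - Rf N f z) * α * (z k - z (k + 1)))|
      ≤ α * E * S / (N : ℝ) ^ 2 := by
    have heq : ∀ k : ℤ,
        (Rf N f (z + ((N : ℝ))⁻¹ • eZ k) - Rf N f z) * α * (z (k - 1) - z k) +
        (Rf N f (z - ((N : ℝ))⁻¹ • eZ k) - Rf N f z) * α * (z k - z (k + 1)) =
        α / (N : ℝ) ^ 2 * (f ((k : ℝ) / N) * (z (k - 1) - 2 * z k + z (k + 1))) := by
      intro k
      rw [hsub _ (abs_eZ_le_one k), Rf_add_smul hf hz1 (abs_eZ_le_one k), Rf_eZ]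
      field_simp
      ring
    rw [tsum_congr heq, tsum_mul_left,
      tsum_mul_second_difference (a := fun k : ℤ => f ((k : ℝ) / N)) hf hz1]
    have hb : |∑' k : ℤ, (f (((k + 1 : ℤ) : ℝ) / N) - 2 * f ((k : ℝ) / N) +
        f (((k - 1 : ℤ) : ℝ) / N)) * z k| ≤ E * (1 / (N : ℝ)) ^ 2 * T := by
      refine abs_tsum_le_of_hasSum (hT'.mul_left (E * (1 / (N : ℝ)) ^ 2)) fun k => ?_
      rw [abs_mul]
      refine (mul_le_of_le_one_right (abs_nonneg _) (hz1 k)).trans ?_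
      have := hE' ((k : ℝ) / N) (1 / (N : ℝ)) (by positivity) ((div_le_one hNpos).2 hN1)
      push_cast
      rwa [add_div, sub_div]
    rw [abs_mul, abs_mul, abs_of_nonneg hNpos.le, abs_of_nonneg (by positivity)]
    calc (N : ℝ) * (α / (N : ℝ) ^ 2 * _)
        ≤ (N : ℝ) * (α / (N : ℝ) ^ 2 * (E * (1 / (N : ℝ)) ^ 2 * (N * S))) := by
          gcongr
          refine hb.trans ?_
          gcongr
      _ = α * E * S / (N : ℝ) ^ 2 := by
          field_simp
  have hint : |(N : ℝ) * (μ / (N : ℝ) ^ 2) * ∑' l : ℤ, ∑' k : ℤ,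
      if l < k then
        (Rf N f (z - ((N : ℝ))⁻¹ • eBlock l k) - Rf N f z) * (z k - z (k + 1)) *
          (z l - z (l + 1))
      else 0| ≤ μ * D * S / (N : ℝ) ^ 2 := by
    have hB : |∑' l : ℤ, ∑' k : ℤ,
        if l < k then
          (Rf N f (z - ((N : ℝ))⁻¹ • eBlock l k) - Rf N f z) * (z k - z (k + 1)) *
            (z l - z (l + 1))
        else 0| ≤ ((N : ℝ))⁻¹ * (D * S) * P * P := by
      refine abs_tsum_le_of_hasSum (hP.mul_left (((N : ℝ))⁻¹ * (D * S) * P)) fun l => ?_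
      refine abs_tsum_le_of_hasSum
        ((hP.mul_left (((N : ℝ))⁻¹ * (D * S))).mul_right (z l - z (l + 1))) fun k => ?_
      have hk := HN.nonneg_sub hz k
      have hl := HN.nonneg_sub hz l
      split_ifs with h
      · rw [hsub _ (abs_eBlock_le_one l k), abs_mul, abs_mul, abs_mul,
          abs_neg, abs_of_nonneg hk, abs_of_nonneg hl, abs_of_nonneg (inv_nonneg.2 hNpos.le)]
        gcongr
        exact hRf _ (abs_eBlock_le_one l k)
      · rw [abs_zero]
        positivity
    rw [abs_mul, abs_of_nonneg (by positivity)]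
    calc (N : ℝ) * (μ / (N : ℝ) ^ 2) * _
        ≤ (N : ℝ) * (μ / (N : ℝ) ^ 2) * (((N : ℝ))⁻¹ * (D * S) * 1 * 1) := by
          gcongr
          refine hB.trans ?_
          gcongr
      _ = μ * D * S / (N : ℝ) ^ 2 := by
          field_simp
  unfold LN
  refine (abs_add_le _ _).trans ?_
  rw [add_div]
  exact add_le_add hdiff hint
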